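/- Fix n ≥ 1, γ > 0, q ∈ (0,1), c ≥ 0, and let Y_i = X_i + N_i for i = 1,…,n, where N_1,…,N_n are i.i.d. standard Gaussian independent of (X_1,…,X_n). For every joint input distribution μ ∈ Λⁿ(γ,q,c), the cyclic average ν = (1/n) Σ_{k=0}^{n−1} T_k(μ), where T_k(μ) is the distribution of the cyclically shifted vector (X_{k+1},…,X_n,X_1,…,X_k), again belongs to Λⁿ(γ,q,c), is invariant under cyclic shifts, and satisfies I(Xⁿ;Yⁿ) under ν ≥ I(Xⁿ;Yⁿ) under μ. Consequently the maximum of I(Xⁿ;Yⁿ) over Λⁿ(γ,q,c) is achieved by a stationary (shift-averaged) distribution. -/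

import Mathlib

open MeasureTheory ProbabilityTheory Real Filter
open scoped ENNReal

/-- Kullback–Leibler divergence `D(μ ∥ ν)` with values in `[0,∞]`: it is
`∫ log(dμ/dν) dμ` when `μ ≪ ν` and the log-likelihood ratio is integrable, and `∞` otherwise. -/
noncomputable def KLD {α : Type*} [MeasurableSpace α] (μ ν : Measure α) : ℝ≥0∞ :=
  open scoped Classical in
  if μ ≪ ν ∧ Integrable (fun x => Real.log ((μ.rnDeriv ν x).toReal)) μ then
    ENNReal.ofReal (∫ x, Real.log ((μ.rnDeriv ν x).toReal) ∂μ)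
  else ⊤

/-- Mutual information of a joint law on a product space: the KL divergence between the joint
law and the product of its marginals. -/
noncomputable def MIm {α β : Type*} [MeasurableSpace α] [MeasurableSpace β]
    (ρ : Measure (α × β)) : ℝ≥0∞ :=
  KLD ρ ((ρ.map Prod.fst).prod (ρ.map Prod.snd))

/-- Mutual information `I(U;V)` of two random variables `U, V` on `(Ω, P)`. -/
noncomputable def MIrv {Ω α β : Type*} [MeasurableSpace Ω] [MeasurableSpace α]
    [MeasurableSpace β] (P : Measure Ω) (U : Ω → α) (V : Ω → β) : ℝ≥0∞ :=
  MIm (P.map fun ω => (U ω, V ω))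

/-- The cyclic shift by `k` of a vector indexed by `Fin n`. -/
def cycShift (n : ℕ) [NeZero n] (k : Fin n) (x : Fin n → ℝ) : Fin n → ℝ := fun i => x (i + k)

/-- The constraint set `Λⁿ(γ,q,c)`: probability laws of `(X_1,…,X_n)` satisfying the cyclic
duty cycle constraint
`(1/n) Σ_i [P(X_i = 0) − 2c P(X_i = 0, X_{i mod n + 1} ≠ 0)] ≥ q`
and the power constraint `E[(1/n) Σ_i X_i²] ≤ γ`. -/
def memLamN (n : ℕ) [NeZero n] (γ q c : ℝ) (μ : Measure (Fin n → ℝ)) : Prop :=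
  IsProbabilityMeasure μ ∧
  q ≤ (1 / (n : ℝ)) * ∑ i : Fin n,
      ((μ {x | x i = 0}).toReal - 2 * c * (μ {x | x i = 0 ∧ x (i + 1) ≠ 0}).toReal) ∧
  ∫⁻ x, ENNReal.ofReal ((1 / (n : ℝ)) * ∑ i : Fin n, (x i) ^ 2) ∂μ ≤ ENNReal.ofReal γ

/-- The input-output mutual information `I(Xⁿ;Yⁿ)` of the memoryless AWGN channel
`Y_i = X_i + N_i` with i.i.d. standard Gaussian noise, for input law `μ`. -/
noncomputable def chanMIn (n : ℕ) (μ : Measure (Fin n → ℝ)) : ℝ≥0∞ :=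
  MIrv (μ.prod (Measure.pi fun _ : Fin n => gaussianReal 0 1))
    (fun p => p.1) (fun p => fun i => p.1 i + p.2 i)

/-- The cyclic average `(1/n) Σ_k T_k(μ)` of an input law `μ`. -/
noncomputable def cycAvg (n : ℕ) [NeZero n] (μ : Measure (Fin n → ℝ)) : Measure (Fin n → ℝ) :=
  ((n : ℝ≥0∞))⁻¹ • ∑ k : Fin n, μ.map (cycShift n k)

noncomputable def gphi (n : ℕ) (z : Fin n → ℝ) : ℝ := ∏ i, gaussianPDFReal 0 1 (z i)

lemma gphi_meas (n : ℕ) : Measurable (gphi n) := by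
  unfold gphi
  exact Finset.measurable_prod _ fun i _ =>
    (measurable_gaussianPDFReal 0 1).comp (measurable_pi_apply i)

lemma gphi_pos (n : ℕ) (z : Fin n → ℝ) : 0 < gphi n z :=
  Finset.prod_pos fun i _ => gaussianPDFReal_pos 0 1 _ one_ne_zero

lemma gpdf_le_one (x : ℝ) : gaussianPDFReal 0 1 x ≤ 1 := by
  unfold gaussianPDFReal
  have h1 : (√(2 * π * ((1 : NNReal) : ℝ)))⁻¹ ≤ 1 := by
    apply inv_le_one_of_one_le₀
    rw [Real.one_le_sqrt]
    have := Real.pi_gt_three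
    simp; linarith
  have h2 : rexp (-(x - 0) ^ 2 / (2 * ((1 : NNReal) : ℝ))) ≤ 1 := by
    rw [Real.exp_le_one_iff]
    simp
    have := sq_nonneg x
    linarith
  exact mul_le_one₀ h1 (Real.exp_pos _).le h2

lemma gphi_le_one (n : ℕ) (z : Fin n → ℝ) : gphi n z ≤ 1 :=
  Finset.prod_le_one (fun i _ => (gaussianPDFReal_pos 0 1 _ one_ne_zero).le)
    fun i _ => gpdf_le_one _

lemma pi_gauss (n : ℕ) : (Measure.pi fun _ : Fin n => gaussianReal 0 1) =
    (volume : Measure (Fin n → ℝ)).withDensity fun z => ENNReal.ofReal (gphi n z) := by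
  refine Measure.pi_eq fun s hs => ?_
  rw [withDensity_apply _ (MeasurableSet.univ_pi hs), volume_pi, Measure.restrict_pi_pi]
  have hint : Integrable (gphi n) (Measure.pi fun i => (volume : Measure ℝ).restrict (s i)) :=
    Integrable.fintype_prod (f := fun _ => gaussianPDFReal 0 1)
      (fun i => (integrable_gaussianPDFReal 0 1).restrict)
  rw [← ofReal_integral_eq_lintegral_ofReal hint (ae_of_all _ fun z => (gphi_pos n z).le)]
  unfold gphi
  rw [integral_fintype_prod_eq_prod (f := fun _ => gaussianPDFReal 0 1),
    ENNReal.ofReal_prod_of_nonneg]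
  · refine Finset.prod_congr rfl fun i _ => ?_
    rw [gaussianReal_apply_eq_integral _ one_ne_zero]
  · exact fun i _ => integral_nonneg fun x => (gaussianPDFReal_pos 0 1 _ one_ne_zero).le

lemma log_gphi_int (n : ℕ) : Integrable (fun z => Real.log (gphi n z))
    (Measure.pi fun _ : Fin n => gaussianReal 0 1) := by
  have h : (fun z => Real.log (gphi n z)) =
      fun z => ∑ i, Real.log (gaussianPDFReal 0 1 (z i)) := by
    funext z
    unfold gphi
    rw [Real.log_prod]
    exact fun i _ => (gaussianPDFReal_pos 0 1 _ one_ne_zero).ne'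
  rw [h]
  refine integrable_finsetSum _ fun i _ => ?_
  refine integrable_comp_eval (μ := fun _ : Fin n => gaussianReal 0 1) (i := i)
    (f := fun x => Real.log (gaussianPDFReal 0 1 x)) ?_
  have h2 : (fun x => Real.log (gaussianPDFReal 0 1 x)) =
      fun x => Real.log (√(2 * π * ((1 : NNReal) : ℝ)))⁻¹ + (- (1/2)) * (x ^ 2) := by
    funext x
    unfold gaussianPDFReal
    rw [Real.log_mul, Real.log_exp]
    · simp; ring
    · have := Real.pi_pos
      positivity
    · exact (Real.exp_pos _).ne'
  rw [h2]
  refine (integrable_const _).add (Integrable.const_mul ?_ _)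
  exact (memLp_id_gaussianReal (μ := 0) (v := 1) 2).integrable_sq

noncomputable def outF (n : ℕ) (μ : Measure (Fin n → ℝ)) (y : Fin n → ℝ) : ℝ≥0∞ :=
  ∫⁻ x, ENNReal.ofReal (gphi n (y - x)) ∂μ

lemma kern_meas (n : ℕ) : Measurable fun p : (Fin n → ℝ) × (Fin n → ℝ) =>
    ENNReal.ofReal (gphi n (p.2 - p.1)) :=
  ((gphi_meas n).comp (measurable_snd.sub measurable_fst)).ennreal_ofReal

lemma outF_meas (n : ℕ) (μ : Measure (Fin n → ℝ)) [SFinite μ] : Measurable (outF n μ) :=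
  (kern_meas n).lintegral_prod_left'

lemma outF_le (n : ℕ) (μ : Measure (Fin n → ℝ)) [IsProbabilityMeasure μ] (y) :
    outF n μ y ≤ 1 := by
  calc outF n μ y ≤ ∫⁻ x, 1 ∂μ := lintegral_mono fun x => by
        simpa using gphi_le_one n _
    _ = 1 := by simp

lemma outF_ne_zero (n : ℕ) (μ : Measure (Fin n → ℝ)) [IsProbabilityMeasure μ] (y) :
    outF n μ y ≠ 0 := by
  unfold outF
  intro h
  have hm : Measurable fun x => ENNReal.ofReal (gphi n (y - x)) :=
    ((gphi_meas n).comp (measurable_const.sub measurable_id)).ennreal_ofReal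
  rw [lintegral_eq_zero_iff hm] at h
  have h3 : ∀ᵐ x ∂μ, False := by
    filter_upwards [h] with x hx
    have := gphi_pos n (y - x)
    simp at hx
    linarith
  simp at h3
  exact IsProbabilityMeasure.ne_zero μ h3

lemma joint_eq (n : ℕ) (μ : Measure (Fin n → ℝ)) [IsProbabilityMeasure μ] :
    (μ.prod (Measure.pi fun _ : Fin n => gaussianReal 0 1)).map
      (fun p => (p.1, fun i => p.1 i + p.2 i)) =
    (μ.prod volume).withDensity fun p => ENNReal.ofReal (gphi n (p.2 - p.1)) := by
  have hmp : MeasurePreserving (fun p : (Fin n → ℝ) × (Fin n → ℝ) => (p.1, p.1 + p.2))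
      (μ.prod volume) (μ.prod volume) :=
    (MeasurePreserving.id μ).skew_product (g := fun x z => x + z)
      (measurable_fst.add measurable_snd) (ae_of_all _ fun a => map_add_left_eq_self _ a)
  rw [pi_gauss, prod_withDensity_right (gphi_meas n).ennreal_ofReal]
  ext s hs
  change (Measure.map (fun p : (Fin n → ℝ) × (Fin n → ℝ) => (p.1, p.1 + p.2)) _) s = _
  rw [Measure.map_apply hmp.measurable hs, withDensity_apply _ hs,
    withDensity_apply _ (hmp.measurable hs), ← hmp.setLIntegral_comp_preimage hs (kern_meas n)]
  simp

/-- The joint law of input and output. -/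
noncomputable def jointL (n : ℕ) (μ : Measure (Fin n → ℝ)) :
    Measure ((Fin n → ℝ) × (Fin n → ℝ)) :=
  (μ.prod (Measure.pi fun _ : Fin n => gaussianReal 0 1)).map
      (fun p => (p.1, fun i => p.1 i + p.2 i))

lemma add_meas (n : ℕ) : Measurable (fun p : (Fin n → ℝ) × (Fin n → ℝ) =>
    (p.1, fun i => p.1 i + p.2 i)) :=
  measurable_fst.prodMk (measurable_fst.add measurable_snd)

instance jointL_prob (n : ℕ) (μ : Measure (Fin n → ℝ)) [IsProbabilityMeasure μ] :
    IsProbabilityMeasure (jointL n μ) :=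
  Measure.isProbabilityMeasure_map (add_meas n).aemeasurable

lemma jointL_fst (n : ℕ) (μ : Measure (Fin n → ℝ)) [IsProbabilityMeasure μ] :
    (jointL n μ).map Prod.fst = μ := by
  unfold jointL
  rw [Measure.map_map measurable_fst (add_meas n)]
  change Measure.map Prod.fst _ = μ
  simp

lemma jointL_snd (n : ℕ) (μ : Measure (Fin n → ℝ)) [IsProbabilityMeasure μ] :
    (jointL n μ).map Prod.snd = volume.withDensity (outF n μ) := by
  unfold jointL
  rw [joint_eq]
  ext s hs
  rw [Measure.map_apply measurable_snd hs, withDensity_apply _ (measurable_snd hs),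
    withDensity_apply _ hs]
  have : (Prod.snd ⁻¹' s : Set ((Fin n → ℝ) × (Fin n → ℝ))) = Set.univ ×ˢ s := by
    ext; simp
  rw [this, ← Measure.prod_restrict, Measure.restrict_univ,
    lintegral_prod_symm' _ (kern_meas n)]
  rfl

lemma jointL_density (n : ℕ) (μ : Measure (Fin n → ℝ)) [IsProbabilityMeasure μ] :
    jointL n μ = (μ.prod (volume.withDensity (outF n μ))).withDensity
      (fun p => (outF n μ p.2)⁻¹ * ENNReal.ofReal (gphi n (p.2 - p.1))) := by
  rw [prod_withDensity_right (outF_meas n μ)]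
  refine Eq.trans ?_ (withDensity_mul _ ((outF_meas n μ).comp measurable_snd)
    (((outF_meas n μ).comp measurable_snd).inv.mul (kern_meas n)))
  unfold jointL
  rw [joint_eq]
  congr 1
  funext p
  simp only [Pi.mul_apply, Function.comp_apply, Pi.inv_apply]
  rw [← mul_assoc, ENNReal.mul_inv_cancel (outF_ne_zero n μ _)
    ((outF_le n μ _).trans_lt ENNReal.one_lt_top).ne, one_mul]

/-- The additive constant (negative noise entropy). -/
noncomputable def negH (n : ℕ) : ℝ :=
  ∫ z, Real.log (gphi n z) ∂(Measure.pi fun _ : Fin n => gaussianReal 0 1)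

lemma noise_int (n : ℕ) (μ : Measure (Fin n → ℝ)) [IsProbabilityMeasure μ] :
    Integrable (fun p => Real.log (gphi n (p.2 - p.1))) (jointL n μ) ∧
    ∫ p, Real.log (gphi n (p.2 - p.1)) ∂(jointL n μ) = negH n := by
  have hm : Measurable fun p : (Fin n → ℝ) × (Fin n → ℝ) => Real.log (gphi n (p.2 - p.1)) :=
    Real.measurable_log.comp ((gphi_meas n).comp (measurable_snd.sub measurable_fst))
  have he : ((fun p : (Fin n → ℝ) × (Fin n → ℝ) => Real.log (gphi n (p.2 - p.1))) ∘
      (fun p : (Fin n → ℝ) × (Fin n → ℝ) => (p.1, fun i => p.1 i + p.2 i))) =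
      fun p => Real.log (gphi n p.2) := by
    funext p
    simp only [Function.comp_apply]
    congr 2
    funext i
    simp
  unfold jointL
  constructor
  · rw [integrable_map_measure hm.aestronglyMeasurable (add_meas n).aemeasurable, he]
    exact (log_gphi_int n).comp_snd μ
  · rw [integral_map (add_meas n).aemeasurable hm.aestronglyMeasurable]
    change ∫ x, ((fun p : (Fin n → ℝ) × (Fin n → ℝ) => Real.log (gphi n (p.2 - p.1))) ∘
      (fun p : (Fin n → ℝ) × (Fin n → ℝ) => (p.1, fun i => p.1 i + p.2 i))) x ∂_ = _
    rw [he, integral_fun_snd (fun z => Real.log (gphi n z))]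
    simp [negH]

lemma out_int (n : ℕ) (μ : Measure (Fin n → ℝ)) [IsProbabilityMeasure μ] :
    (Integrable (fun p => Real.log (outF n μ p.2).toReal) (jointL n μ) ↔
      Integrable (fun y => Real.negMulLog (outF n μ y).toReal)) ∧
    ∫ p, Real.log (outF n μ p.2).toReal ∂(jointL n μ) =
      - ∫ y, Real.negMulLog (outF n μ y).toReal := by
  have hm : Measurable fun y => Real.log (outF n μ y).toReal :=
    Real.measurable_log.comp (outF_meas n μ).ennreal_toReal
  have hlt : ∀ᵐ y, outF n μ y < ∞ := ae_of_all _ fun y =>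
    (outF_le n μ y).trans_lt ENNReal.one_lt_top
  have e1 : (fun p => Real.log (outF n μ p.2).toReal) =
    (fun y => Real.log (outF n μ y).toReal) ∘ (Prod.snd : (Fin n → ℝ) × (Fin n → ℝ) → _) := rfl
  have e2 : (fun y => (outF n μ y).toReal • Real.log (outF n μ y).toReal) =
      fun y => - Real.negMulLog (outF n μ y).toReal := by
    funext y; simp [Real.negMulLog]
  constructor
  · rw [e1, ← integrable_map_measure hm.aestronglyMeasurable measurable_snd.aemeasurable,
      jointL_snd, integrable_withDensity_iff_integrable_smul' (outF_meas n μ) hlt, e2]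
    exact integrable_neg_iff
  · rw [← integral_map (μ := jointL n μ) measurable_snd.aemeasurable
      (f := fun y => Real.log (outF n μ y).toReal) hm.aestronglyMeasurable, jointL_snd,
      integral_withDensity_eq_integral_toReal_smul (outF_meas n μ) hlt, e2, integral_neg]

lemma chan_eq (n : ℕ) (μ : Measure (Fin n → ℝ)) [IsProbabilityMeasure μ] :
    (Integrable (fun y => Real.negMulLog (outF n μ y).toReal) →
      chanMIn n μ = ENNReal.ofReal (negH n + ∫ y, Real.negMulLog (outF n μ y).toReal)) ∧
    (¬ Integrable (fun y => Real.negMulLog (outF n μ y).toReal) → chanMIn n μ = ⊤) := by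
  have h0 : chanMIn n μ = KLD (jointL n μ) (μ.prod (volume.withDensity (outF n μ))) := by
    unfold chanMIn MIrv MIm
    change KLD (jointL n μ) (((jointL n μ).map Prod.fst).prod ((jointL n μ).map Prod.snd)) = _
    rw [jointL_fst, jointL_snd]
  have : IsProbabilityMeasure (volume.withDensity (outF n μ)) := by
    rw [← jointL_snd]
    exact Measure.isProbabilityMeasure_map measurable_snd.aemeasurable
  have hac : jointL n μ ≪ μ.prod (volume.withDensity (outF n μ)) := by
    rw [jointL_density]
    exact withDensity_absolutelyContinuous _ _
  have hrn : (jointL n μ).rnDeriv (μ.prod (volume.withDensity (outF n μ)))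
      =ᵐ[μ.prod (volume.withDensity (outF n μ))]
      (fun p => (outF n μ p.2)⁻¹ * ENNReal.ofReal (gphi n (p.2 - p.1))) := by
    have := Measure.rnDeriv_withDensity (μ.prod (volume.withDensity (outF n μ)))
      (f := fun p => (outF n μ p.2)⁻¹ * ENNReal.ofReal (gphi n (p.2 - p.1)))
      (((outF_meas n μ).comp measurable_snd).inv.mul (kern_meas n))
    rwa [← jointL_density] at this
  have hlog : (fun p => Real.log ((jointL n μ).rnDeriv
      (μ.prod (volume.withDensity (outF n μ))) p).toReal) =ᵐ[jointL n μ]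
      fun p => Real.log (gphi n (p.2 - p.1)) - Real.log (outF n μ p.2).toReal := by
    filter_upwards [hac.ae_le hrn] with p hp
    rw [hp, ENNReal.toReal_mul, ENNReal.toReal_inv, ENNReal.toReal_ofReal (gphi_pos n _).le,
      Real.log_mul, Real.log_inv]
    · ring
    · exact inv_ne_zero (ENNReal.toReal_ne_zero.2 ⟨outF_ne_zero n μ _,
        ((outF_le n μ _).trans_lt ENNReal.one_lt_top).ne⟩)
    · exact (gphi_pos n _).ne'
  obtain ⟨n1, n2⟩ := noise_int n μ
  obtain ⟨o1, o2⟩ := out_int n μ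
  constructor
  · intro h
    have hi := o1.2 h
    rw [h0, KLD, if_pos ⟨hac, (n1.sub hi).congr hlog.symm⟩, integral_congr_ae hlog,
      integral_sub n1 hi, n2, o2, sub_neg_eq_add]
  · intro h
    rw [h0, KLD, if_neg]
    rintro ⟨-, hi⟩
    apply h
    rw [← o1]
    have := n1.sub (hi.congr hlog)
    refine this.congr (ae_of_all _ fun p => ?_)
    simp

lemma cyc_meas (n : ℕ) [NeZero n] (k : Fin n) : Measurable (cycShift n k) :=
  measurable_pi_lambda _ fun i => measurable_pi_apply (i + k)

lemma cyc_mp (n : ℕ) [NeZero n] (k : Fin n) :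
    MeasurePreserving (cycShift n k) volume volume := by
  refine ⟨cyc_meas n k, ?_⟩
  rw [volume_pi]
  symm
  refine Measure.pi_eq fun s hs => ?_
  rw [Measure.map_apply (cyc_meas n k) (MeasurableSet.univ_pi hs)]
  have : cycShift n k ⁻¹' (Set.univ.pi s) = Set.univ.pi fun j => s (j - k) := by
    ext x
    simp only [Set.mem_preimage, Set.mem_univ_pi, cycShift]
    constructor
    · intro h j
      simpa using h (j - k)
    · intro h j
      simpa using h (j + k)
  rw [this, Measure.pi_pi]
  exact Equiv.prod_comp (Equiv.subRight k) (fun i => volume (s i))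

lemma cyc_cyc (n : ℕ) [NeZero n] (k l : Fin n) (x : Fin n → ℝ) :
    cycShift n k (cycShift n l x) = cycShift n (k + l) x := by
  funext i
  simp [cycShift, add_assoc]

lemma cyc_zero (n : ℕ) [NeZero n] (x : Fin n → ℝ) : cycShift n 0 x = x := by
  funext i
  simp [cycShift]

lemma gphi_cyc (n : ℕ) [NeZero n] (k : Fin n) (x : Fin n → ℝ) :
    gphi n (cycShift n k x) = gphi n x :=
  Equiv.prod_comp (Equiv.addRight k) (fun i => gaussianPDFReal 0 1 (x i))

lemma n_ne (n : ℕ) [NeZero n] : (n : ℝ≥0∞) ≠ 0 := by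
  exact_mod_cast NeZero.ne n

lemma cycAvg_lintegral (n : ℕ) [NeZero n] (μ : Measure (Fin n → ℝ)) (f : (Fin n → ℝ) → ℝ≥0∞)
    (hf : Measurable f) :
    ∫⁻ x, f x ∂(cycAvg n μ) = (n : ℝ≥0∞)⁻¹ * ∑ k, ∫⁻ x, f (cycShift n k x) ∂μ := by
  unfold cycAvg
  rw [lintegral_smul_measure, lintegral_finsetSum_measure, smul_eq_mul]
  congr 1
  exact Finset.sum_congr rfl fun k _ => lintegral_map hf (cyc_meas n k)

lemma cycAvg_apply (n : ℕ) [NeZero n] (μ : Measure (Fin n → ℝ)) (s : Set (Fin n → ℝ))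
    (hs : MeasurableSet s) :
    cycAvg n μ s = (n : ℝ≥0∞)⁻¹ * ∑ k, μ (cycShift n k ⁻¹' s) := by
  unfold cycAvg
  rw [Measure.smul_apply, Measure.finsetSum_apply, smul_eq_mul]
  congr 1
  exact Finset.sum_congr rfl fun k _ => Measure.map_apply (cyc_meas n k) hs

lemma cycAvg_prob (n : ℕ) [NeZero n] (μ : Measure (Fin n → ℝ)) [IsProbabilityMeasure μ] :
    IsProbabilityMeasure (cycAvg n μ) := by
  constructor
  rw [cycAvg_apply n μ _ MeasurableSet.univ]
  simp only [Set.preimage_univ, measure_univ, Finset.sum_const, Finset.card_univ,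
    Fintype.card_fin, nsmul_eq_mul, mul_one]
  exact ENNReal.inv_mul_cancel (n_ne n) (ENNReal.natCast_ne_top n)

lemma cycAvg_toReal (n : ℕ) [NeZero n] (μ : Measure (Fin n → ℝ)) [IsProbabilityMeasure μ]
    (s : Set (Fin n → ℝ)) (hs : MeasurableSet s) :
    (cycAvg n μ s).toReal = (1 / (n : ℝ)) * ∑ k, (μ (cycShift n k ⁻¹' s)).toReal := by
  rw [cycAvg_apply n μ s hs, ENNReal.toReal_mul, ENNReal.toReal_sum fun k _ => measure_ne_top _ _]
  simp

lemma cycAvg_inv (n : ℕ) [NeZero n] (μ : Measure (Fin n → ℝ)) (k : Fin n) :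
    (cycAvg n μ).map (cycShift n k) = cycAvg n μ := by
  ext s hs
  rw [Measure.map_apply (cyc_meas n k) hs, cycAvg_apply n μ _ (cyc_meas n k hs),
    cycAvg_apply n μ s hs]
  congr 1
  rw [← Equiv.sum_comp (Equiv.addLeft k) (fun l => μ (cycShift n l ⁻¹' s))]
  refine Finset.sum_congr rfl fun l _ => ?_
  congr 1
  ext x
  simp [cyc_cyc]

lemma cycAvg_mem (n : ℕ) [NeZero n] (γ q c : ℝ) (μ : Measure (Fin n → ℝ))
    (hμ : memLamN n γ q c μ) : memLamN n γ q c (cycAvg n μ) := by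
  obtain ⟨hp, hd, hpow⟩ := hμ
  have hn : (n : ℝ) ≠ 0 := by exact_mod_cast NeZero.ne n
  refine ⟨cycAvg_prob n μ, hd.trans (le_of_eq ?_), le_of_eq_of_le ?_ hpow⟩
  · congr 1
    have key : ∀ i : Fin n, ((cycAvg n μ {x | x i = 0}).toReal -
        2 * c * (cycAvg n μ {x | x i = 0 ∧ x (i + 1) ≠ 0}).toReal) =
        (1 / (n : ℝ)) * ∑ k : Fin n, ((μ {x | x (i + k) = 0}).toReal -
        2 * c * (μ {x | x (i + k) = 0 ∧ x (i + k + 1) ≠ 0}).toReal) := by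
      intro i
      have m1 : MeasurableSet {x : Fin n → ℝ | x i = 0} :=
        measurable_pi_apply i (measurableSet_singleton 0)
      have m2 : MeasurableSet {x : Fin n → ℝ | x i = 0 ∧ x (i + 1) ≠ 0} :=
        m1.inter (measurable_pi_apply (i + 1) (measurableSet_singleton 0)).compl
      rw [cycAvg_toReal n μ _ m1, cycAvg_toReal n μ _ m2, Finset.sum_sub_distrib,
        ← Finset.mul_sum]
      have e1 : ∀ k, cycShift n k ⁻¹' {x : Fin n → ℝ | x i = 0} = {x | x (i + k) = 0} :=
        fun k => rfl
      have e2 : ∀ k, cycShift n k ⁻¹' {x : Fin n → ℝ | x i = 0 ∧ x (i + 1) ≠ 0} =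
          {x | x (i + k) = 0 ∧ x (i + k + 1) ≠ 0} := by
        intro k
        rw [add_right_comm]
        rfl
      simp_rw [e1, e2]
      ring
    simp_rw [key]
    rw [← Finset.mul_sum, Finset.sum_comm]
    have h2 : ∀ k : Fin n, ∑ i : Fin n, ((μ {x | x (i + k) = 0}).toReal -
        2 * c * (μ {x | x (i + k) = 0 ∧ x (i + k + 1) ≠ 0}).toReal) =
        ∑ i : Fin n, ((μ {x | x i = 0}).toReal -
        2 * c * (μ {x | x i = 0 ∧ x (i + 1) ≠ 0}).toReal) := fun k =>
      Equiv.sum_comp (Equiv.addRight k) (fun i => ((μ {x | x i = 0}).toReal -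
        2 * c * (μ {x | x i = 0 ∧ x (i + 1) ≠ 0}).toReal))
    simp_rw [h2]
    simp only [Finset.sum_const, Finset.card_univ, Fintype.card_fin, nsmul_eq_mul]
    field_simp
  · have hm : Measurable fun x : Fin n → ℝ =>
        ENNReal.ofReal ((1 / (n : ℝ)) * ∑ i : Fin n, (x i) ^ 2) := by fun_prop
    rw [cycAvg_lintegral n μ _ hm]
    have h2 : ∀ (k : Fin n) (x : Fin n → ℝ), ∑ i : Fin n, (cycShift n k x i) ^ 2 =
        ∑ i : Fin n, (x i) ^ 2 := fun k x =>
      Equiv.sum_comp (Equiv.addRight k) (fun i => (x i) ^ 2)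
    simp_rw [h2]
    simp only [Finset.sum_const, Finset.card_univ, Fintype.card_fin, nsmul_eq_mul]
    rw [← mul_assoc, ENNReal.inv_mul_cancel (n_ne n) (ENNReal.natCast_ne_top n), one_mul]

lemma outF_cycAvg (n : ℕ) [NeZero n] (μ : Measure (Fin n → ℝ)) [IsProbabilityMeasure μ]
    (y : Fin n → ℝ) : (outF n (cycAvg n μ) y).toReal =
      ∑ k : Fin n, (1 / (n : ℝ)) • (outF n μ (cycShift n (-k) y)).toReal := by
  have hm : Measurable fun x => ENNReal.ofReal (gphi n (y - x)) :=
    ((gphi_meas n).comp (measurable_const.sub measurable_id)).ennreal_ofReal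
  have h : ∀ k x, gphi n (y - cycShift n k x) = gphi n (cycShift n (-k) y - x) := by
    intro k x
    rw [← gphi_cyc n (-k)]
    congr 1
    funext i
    simp [cycShift]
  rw [outF, cycAvg_lintegral n μ _ hm, ENNReal.toReal_mul]
  simp_rw [h]
  change _ * (∑ k, outF n μ (cycShift n (-k) y)).toReal = _
  rw [ENNReal.toReal_sum fun k _ => ((outF_le n μ _).trans_lt ENNReal.one_lt_top).ne,
    Finset.mul_sum]
  simp

lemma chan_le (n : ℕ) [NeZero n] (μ : Measure (Fin n → ℝ)) [IsProbabilityMeasure μ] :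
    chanMIn n μ ≤ chanMIn n (cycAvg n μ) := by
  have := cycAvg_prob n μ
  have hn : (0 : ℝ) < n := by exact_mod_cast Nat.pos_of_ne_zero (NeZero.ne n)
  by_cases hI : Integrable (fun y => Real.negMulLog (outF n (cycAvg n μ) y).toReal)
  swap
  · rw [(chan_eq n (cycAvg n μ)).2 hI]
    exact le_top
  have hnn : ∀ y, 0 ≤ Real.negMulLog (outF n μ y).toReal := fun y =>
    Real.negMulLog_nonneg ENNReal.toReal_nonneg
      (ENNReal.toReal_le_of_le_ofReal zero_le_one (by simpa using outF_le n μ y))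
  have hm : Measurable fun y => Real.negMulLog (outF n μ y).toReal :=
    Real.continuous_negMulLog.measurable.comp (outF_meas n μ).ennreal_toReal
  have hJ : ∀ y, ∑ k : Fin n, (1 / (n : ℝ)) * Real.negMulLog
      (outF n μ (cycShift n (-k) y)).toReal ≤
      Real.negMulLog (outF n (cycAvg n μ) y).toReal := by
    intro y
    rw [outF_cycAvg]
    exact Real.concaveOn_negMulLog.le_map_sum (t := Finset.univ) (w := fun _ => 1 / (n : ℝ))
      (p := fun k : Fin n => (outF n μ (cycShift n (-k) y)).toReal)
      (fun _ _ => by positivity) (by simp [hn.ne']) (fun _ _ => ENNReal.toReal_nonneg)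
  have hI0 : Integrable (fun y => Real.negMulLog (outF n μ y).toReal) := by
    refine (hI.const_mul (n : ℝ)).mono' hm.aestronglyMeasurable (ae_of_all _ fun y => ?_)
    rw [Real.norm_of_nonneg (hnn y)]
    have h1 := Finset.single_le_sum (s := Finset.univ)
      (f := fun k : Fin n => (1 / (n : ℝ)) * Real.negMulLog
        (outF n μ (cycShift n (-k) y)).toReal)
      (fun k _ => mul_nonneg (by positivity) (hnn _)) (Finset.mem_univ 0)
    simp only [neg_zero, cyc_zero] at h1
    have h2 := mul_le_mul_of_nonneg_left (h1.trans (hJ y)) hn.le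
    rwa [← mul_assoc, mul_one_div_cancel hn.ne', one_mul] at h2
  have hIk : ∀ k : Fin n, Integrable (fun y => (1 / (n : ℝ)) * Real.negMulLog
      (outF n μ (cycShift n (-k) y)).toReal) := fun k =>
    ((cyc_mp n (-k)).integrable_comp_of_integrable hI0).const_mul _
  have hEk : ∀ k : Fin n, ∫ y, Real.negMulLog (outF n μ (cycShift n (-k) y)).toReal =
      ∫ y, Real.negMulLog (outF n μ y).toReal := by
    intro k
    have := integral_map (μ := volume) (cyc_meas n (-k)).aemeasurable
      (f := fun y => Real.negMulLog (outF n μ y).toReal) hm.aestronglyMeasurable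
    rw [(cyc_mp n (-k)).map_eq] at this
    exact this.symm
  rw [(chan_eq n (cycAvg n μ)).1 hI, (chan_eq n μ).1 hI0]
  apply ENNReal.ofReal_le_ofReal
  refine add_le_add le_rfl ?_
  have h3 := integral_mono (integrable_finsetSum _ fun k _ => hIk k) hI hJ
  rw [integral_finsetSum _ fun k _ => hIk k] at h3
  simp_rw [integral_const_mul, hEk] at h3
  simp only [Finset.sum_const, Finset.card_univ, Fintype.card_fin, nsmul_eq_mul] at h3
  rwa [← mul_assoc, mul_one_div_cancel hn.ne', one_mul] at h3

/-- for any `μ ∈ Λⁿ(γ,q,c)`, the cyclic average `ν = (1/n) Σ_k T_k(μ)` again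
belongs to `Λⁿ(γ,q,c)`, is invariant under cyclic shifts, and has at least as large
input-output mutual information; consequently, if `μ` maximizes `I(Xⁿ;Yⁿ)` over `Λⁿ(γ,q,c)`,
then so does the stationary (shift-averaged) law `ν`. -/
theorem cycAvg_stationary_maximizer (n : ℕ) [NeZero n] (γ q c : ℝ)
    (hγ : 0 < γ) (hq : q ∈ Set.Ioo (0 : ℝ) 1) (hc : 0 ≤ c)
    (μ : Measure (Fin n → ℝ)) (hμ : memLamN n γ q c μ) :
    memLamN n γ q c (cycAvg n μ) ∧
    (∀ k : Fin n, (cycAvg n μ).map (cycShift n k) = cycAvg n μ) ∧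
    chanMIn n μ ≤ chanMIn n (cycAvg n μ) ∧
    ((∀ μ' : Measure (Fin n → ℝ), memLamN n γ q c μ' → chanMIn n μ' ≤ chanMIn n μ) →
      ∀ μ' : Measure (Fin n → ℝ), memLamN n γ q c μ' → chanMIn n μ' ≤ chanMIn n (cycAvg n μ)) := by

  have := hμ.1
  have h := chan_le n μ
  exact ⟨cycAvg_mem n γ q c μ hμ, cycAvg_inv n μ, h, fun hmax μ' hμ' => (hmax μ' hμ').trans h⟩
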